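/- arXiv:1508.01726 — 2 statements merged into one kernel-verified Lean document; each statement's English description precedes it below -/
import Mathlib

section
/- Let p and q be distinct primes and set ξ = log q / log p (a positive irrational real number). Assume (a,b) is an upper or lower best approximation for ξ, and set α = p^a/q^b. Let ℬ(α) ⊆ ℱ(α) be the set of factorizations (p^{a₁}/q^{b₁},…,p^{a_N}/q^{b_N}) of α such that every (aₙ,bₙ) is an upper or lower best approximation for ξ. Then for every real t > 0, min_{A ∈ ℱ(α)} f_A(t) = min_{A ∈ ℬ(α)} f_A(t); that is, ℬ(α) is an infimum set for α. -/
open Real Finset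

/-- `𝒩` is encoded by pairs `x : ℕ × ℕ` with `x ≠ (0,0)`.
The upper set `𝒰(ξ) = {(a,b) ∈ 𝒩 : a > bξ}`. -/
def Uset (ξ : ℝ) : Set (ℕ × ℕ) := {x | x ≠ (0, 0) ∧ (x.2 : ℝ) * ξ < (x.1 : ℝ)}

/-- The lower set `ℒ(ξ) = {(a,b) ∈ 𝒩 : a < bξ}`. -/
def Lset (ξ : ℝ) : Set (ℕ × ℕ) := {x | x ≠ (0, 0) ∧ (x.1 : ℝ) < (x.2 : ℝ) * ξ}

/-- `𝒢 = {(a,b) ∈ 𝒩 : gcd(a,b) = 1}`. -/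
def Gset : Set (ℕ × ℕ) := {x | x ≠ (0, 0) ∧ Nat.Coprime x.1 x.2}

/-- `𝒰₁(ξ)`: elements `(a,b)` of `𝒰(ξ)` with `a/b ≤ m/n` (by cross multiplication)
for every `(m,n) ∈ 𝒰(ξ)` with `m ≤ a`. -/
def U1 (ξ : ℝ) : Set (ℕ × ℕ) :=
  {x | x ∈ Uset ξ ∧ ∀ y ∈ Uset ξ, y.1 ≤ x.1 → x.1 * y.2 ≤ y.1 * x.2}

/-- `𝒰₂(ξ)`: elements `(a,b)` of `𝒰(ξ)` with `a/b ≤ m/n` for every `(m,n) ∈ 𝒰(ξ)`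
with `n ≤ b`. -/
def U2 (ξ : ℝ) : Set (ℕ × ℕ) :=
  {x | x ∈ Uset ξ ∧ ∀ y ∈ Uset ξ, y.2 ≤ x.2 → x.1 * y.2 ≤ y.1 * x.2}

/-- `ℒ₁(ξ)`: elements `(a,b)` of `ℒ(ξ)` with `a/b ≥ m/n` for every `(m,n) ∈ ℒ(ξ)`
with `m ≤ a`. -/
def L1 (ξ : ℝ) : Set (ℕ × ℕ) :=
  {x | x ∈ Lset ξ ∧ ∀ y ∈ Lset ξ, y.1 ≤ x.1 → y.1 * x.2 ≤ x.1 * y.2}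

/-- `ℒ₂(ξ)`: elements `(a,b)` of `ℒ(ξ)` with `a/b ≥ m/n` for every `(m,n) ∈ ℒ(ξ)`
with `n ≤ b`. -/
def L2 (ξ : ℝ) : Set (ℕ × ℕ) :=
  {x | x ∈ Lset ξ ∧ ∀ y ∈ Lset ξ, y.2 ≤ x.2 → y.1 * x.2 ≤ x.1 * y.2}

/-- `(a,b)` is an upper or lower best approximation for `ξ`. -/
def BestApprox (ξ : ℝ) (x : ℕ × ℕ) : Prop :=
  x ∈ Gset ∩ U1 ξ ∨ x ∈ Gset ∩ L2 ξ

/-- A factorization of a positive rational `α ≠ 1`: a tuple of fractions `r n / s n` of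
positive integers, none equal to `1`, with `gcd (r m) (s n) = 1` for all `m, n`, whose
product is `α`. -/
def IsFactorization (α : ℚ) {N : ℕ} (r s : Fin N → ℕ) : Prop :=
  (∀ n, 0 < r n) ∧ (∀ n, 0 < s n) ∧ (∀ n, (r n : ℚ) / (s n : ℚ) ≠ 1) ∧
    (∀ m n, Nat.Coprime (r m) (s n)) ∧ (∏ n, (r n : ℚ) / (s n : ℚ)) = α

/-- The measure function `f_A(t) = (Σₙ m(rₙ/sₙ)^t)^{1/t}` of a factorization, where
`m(rₙ/sₙ) = log max(rₙ, sₙ)`. -/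
noncomputable def fmeas {N : ℕ} (r s : Fin N → ℕ) (t : ℝ) : ℝ :=
  (∑ n, (Real.log ((max (r n) (s n) : ℕ) : ℝ)) ^ t) ^ (1 / t)


namespace MainCorAux

/-- Weight of a pair. -/
noncomputable def wt (P Q : ℝ) (x : ℕ × ℕ) : ℝ := max (x.1 * P) (x.2 * Q)

/-- Sum of `t`-th powers of weights. -/
noncomputable def W (P Q t : ℝ) (s : Multiset (ℕ × ℕ)) : ℝ := (s.map fun x => wt P Q x ^ t).sum

/-- Upper best approximation, in homogeneous form. -/
def Best (P Q : ℝ) (x : ℕ × ℕ) : Prop :=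
  Nat.Coprime x.1 x.2 ∧ x.2 * Q < x.1 * P ∧
    ∀ y : ℕ × ℕ, y.2 * Q < y.1 * P → y.1 ≤ x.1 → x.1 * y.2 ≤ y.1 * x.2

lemma W_cons (P Q t : ℝ) (x : ℕ × ℕ) (s : Multiset (ℕ × ℕ)) :
    W P Q t (x ::ₘ s) = wt P Q x ^ t + W P Q t s := by
  simp [W]

lemma wt_swap (P Q : ℝ) (x : ℕ × ℕ) : wt Q P x.swap = wt P Q x := by
  simp [wt, max_comm]

lemma W_swap (P Q t : ℝ) (s : Multiset (ℕ × ℕ)) : W Q P t (s.map Prod.swap) = W P Q t s := by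
  simp [W, Function.comp_def, wt_swap]

lemma sum_swap (s : Multiset (ℕ × ℕ)) : (s.map Prod.swap).sum = s.sum.swap := by
  induction s using Multiset.induction_on with
  | empty => rfl
  | cons x s ih => simp [ih, Prod.ext_iff]

lemma wt_nonneg {P Q : ℝ} (hP : 0 < P) (x : ℕ × ℕ) : 0 ≤ wt P Q x :=
  le_max_of_le_left (by positivity)

lemma wt_add_le (P Q : ℝ) (x y : ℕ × ℕ) : wt P Q (x + y) ≤ wt P Q x + wt P Q y := by
  simp only [wt, Prod.fst_add, Prod.snd_add, Nat.cast_add, add_mul]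
  apply max_le
  · exact add_le_add (le_max_left _ _) (le_max_left _ _)
  · exact add_le_add (le_max_right _ _) (le_max_right _ _)

lemma wt_zero (P Q : ℝ) : wt P Q 0 = 0 := by simp [wt]

lemma wt_upper {P Q : ℝ} {x : ℕ × ℕ} (h : x.2 * Q < x.1 * P) : wt P Q x = x.1 * P :=
  max_eq_left h.le

lemma W_small {P Q t : ℝ} (hP : 0 < P) (ht : 0 < t) (ht1 : t ≤ 1)
    (s : Multiset (ℕ × ℕ)) : wt P Q s.sum ^ t ≤ W P Q t s := by
  induction s using Multiset.induction_on with
  | empty => simp [W, wt_zero, Real.zero_rpow ht.ne']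
  | cons x s ih =>
    rw [W_cons, Multiset.sum_cons]
    calc wt P Q (x + s.sum) ^ t ≤ (wt P Q x + wt P Q s.sum) ^ t :=
          Real.rpow_le_rpow (wt_nonneg hP _) (wt_add_le _ _ _ _) ht.le
      _ ≤ wt P Q x ^ t + wt P Q s.sum ^ t :=
          Real.rpow_add_le_add_rpow (wt_nonneg hP _) (wt_nonneg hP _) ht.le ht1
      _ ≤ _ := by linarith

lemma strict_split {t u v : ℝ} (ht : 1 < t) (hu : 0 < u) (hv : 0 < v) :
    u ^ t + v ^ t < (u + v) ^ t := by
  have key : ∀ z : ℝ, 0 < z → z ^ t = z * z ^ (t - 1) := by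
    intro z hz
    rw [Real.rpow_sub_one hz.ne']; field_simp
  rw [key u hu, key v hv, key (u + v) (by positivity), add_mul]
  have h1 : u ^ (t - 1) < (u + v) ^ (t - 1) :=
    Real.rpow_lt_rpow hu.le (by linarith) (by linarith)
  have h2 : v ^ (t - 1) < (u + v) ^ (t - 1) :=
    Real.rpow_lt_rpow hv.le (by linarith) (by linarith)
  have := mul_lt_mul_of_pos_left h1 hu
  have := mul_lt_mul_of_pos_left h2 hv
  linarith

lemma sum_upper {P Q : ℝ} (s : Multiset (ℕ × ℕ)) (h : ∀ x ∈ s, (x.2 : ℝ) * Q < x.1 * P) :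
    (s.sum.2 : ℝ) * Q ≤ s.sum.1 * P := by
  induction s using Multiset.induction_on with
  | empty => simp
  | cons x s ih =>
    have h1 := h x (by simp)
    have h2 := ih (fun y hy => h y (by simp [hy]))
    simp only [Multiset.sum_cons, Prod.fst_add, Prod.snd_add, Nat.cast_add, add_mul]
    linarith

/-- The splitting step. -/
lemma no_split {P Q t : ℝ} (hP : 0 < P) (hQ : 0 < Q) (ht : 1 < t)
    (s : Multiset (ℕ × ℕ)) (hmin : ∀ s' : Multiset (ℕ × ℕ), s'.sum = s.sum → W P Q t s ≤ W P Q t s')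
    (y z : ℕ × ℕ) (hx : y + z ∈ s) (hy : (y.2 : ℝ) * Q < y.1 * P) (hz : (z.2 : ℝ) * Q < z.1 * P) :
    False := by
  obtain ⟨r, rfl⟩ := Multiset.exists_cons_of_mem hx
  have h := hmin (y ::ₘ z ::ₘ r) (by simp [add_assoc])
  have hyz : (((y + z).2 : ℕ) : ℝ) * Q < ((y + z).1 : ℕ) * P := by
    simp only [Prod.fst_add, Prod.snd_add, Nat.cast_add, add_mul]; linarith
  rw [W_cons, W_cons, W_cons, wt_upper hy, wt_upper hz, wt_upper hyz] at h
  have h1 : 0 < (y.1 : ℝ) * P := lt_of_le_of_lt (by positivity) hy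
  have h2 : 0 < (z.1 : ℝ) * P := lt_of_le_of_lt (by positivity) hz
  have := strict_split ht h1 h2
  simp only [Prod.fst_add, Nat.cast_add, add_mul] at h
  linarith

lemma floor_step {P Q t : ℝ} (hP : 0 < P) (hQ : 0 < Q)
    (hirr : ∀ x : ℕ × ℕ, (x.1 : ℝ) * P = x.2 * Q → x = 0) (ht : 0 < t)
    (s : Multiset (ℕ × ℕ)) (h0 : 0 ∉ s)
    (hmin : ∀ s' : Multiset (ℕ × ℕ), s'.sum = s.sum → W P Q t s ≤ W P Q t s')
    (hs : Best P Q s.sum ∨ Best Q P s.sum.swap)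
    (x : ℕ × ℕ) (hx : x ∈ s) : ¬ ((x.2 + 1 : ℝ) * Q < x.1 * P) := by
  intro hlt
  have hxU : (x.2 : ℝ) * Q < x.1 * P := by nlinarith
  by_cases hL : ∃ y ∈ s, (y.1 : ℝ) * P < y.2 * Q
  · obtain ⟨y, hys, hyL⟩ := hL
    obtain ⟨r, rfl⟩ := Multiset.exists_cons_of_mem hx
    have hyx : y ≠ x := by rintro rfl; linarith
    have hyr : y ∈ r := by simpa [hyx] using hys
    obtain ⟨r, rfl⟩ := Multiset.exists_cons_of_mem hyr
    obtain ⟨y1, y2⟩ := y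
    have hy2 : y2 ≠ 0 := by
      rintro rfl
      have : (0 : ℝ) ≤ (y1 : ℝ) * P := by positivity
      simp at hyL; linarith
    obtain ⟨k, rfl⟩ := Nat.exists_eq_succ_of_ne_zero hy2
    have h := hmin ((x.1, x.2 + 1) ::ₘ (y1, k) ::ₘ r) (by
      simp only [Multiset.sum_cons, Prod.ext_iff, Prod.fst_add, Prod.snd_add]
      constructor <;> simp only [Nat.succ_eq_add_one] <;> ring)
    rw [W_cons, W_cons, W_cons, W_cons, wt_upper hxU,
      wt_upper (x := (x.1, x.2 + 1)) (by push_cast; exact hlt)] at h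
    have : wt P Q (y1, k) ^ t < wt P Q (y1, k.succ) ^ t := by
      apply Real.rpow_lt_rpow (wt_nonneg hP _) _ ht
      simp only [wt] at hyL ⊢
      apply lt_max_of_lt_right
      apply max_lt hyL
      push_cast; nlinarith
    linarith
  · push Not at hL
    have hU : ∀ y ∈ s, (y.2 : ℝ) * Q < y.1 * P := by
      intro y hy
      refine lt_of_le_of_ne (hL y hy) fun h => h0 ?_
      rw [← hirr y h.symm]; exact hy
    obtain ⟨r, rfl⟩ := Multiset.exists_cons_of_mem hx
    have hr := sum_upper r (fun y hy => hU y (by simp [hy]))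
    have hT : ((x ::ₘ r).sum.2 + 1 : ℝ) * Q < (x ::ₘ r).sum.1 * P := by
      simp only [Multiset.sum_cons, Prod.fst_add, Prod.snd_add, Nat.cast_add, add_mul] at hlt ⊢
      linarith
    generalize (x ::ₘ r).sum = T at hT hs
    rcases hs with hs | hs
    · have := hs.2.2 (T.1, T.2 + 1) (by push_cast; exact hT) le_rfl
      have hT0 : T.1 ≠ 0 := by
        intro h
        have h' := hs.2.1
        rw [h] at h'
        have : (0 : ℝ) ≤ (T.2 : ℝ) * Q := by positivity
        simp at h'; linarith
      simp only at this
      have : 0 < T.1 := Nat.pos_of_ne_zero hT0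
      nlinarith
    · have := hs.2.1
      simp only [Prod.snd_swap, Prod.fst_swap] at this
      nlinarith

lemma upper_best {P Q t : ℝ} (hP : 0 < P) (hQ : 0 < Q)
    (hirr : ∀ x : ℕ × ℕ, (x.1 : ℝ) * P = x.2 * Q → x = 0) (ht : 1 < t)
    (s : Multiset (ℕ × ℕ)) (h0 : 0 ∉ s)
    (hmin : ∀ s' : Multiset (ℕ × ℕ), s'.sum = s.sum → W P Q t s ≤ W P Q t s')
    (hs : Best P Q s.sum ∨ Best Q P s.sum.swap)
    (x : ℕ × ℕ) (hx : x ∈ s) (hxU : (x.2 : ℝ) * Q < x.1 * P) : Best P Q x := by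
  have hfl := floor_step hP hQ hirr (by linarith) s h0 hmin hs x hx
  obtain ⟨c, d⟩ := x
  simp only at hfl hxU
  have hc : 0 < c := by
    rcases Nat.eq_zero_or_pos c with rfl | h
    · have : (0 : ℝ) ≤ (d : ℝ) * Q := by positivity
      simp at hxU; linarith
    · exact h
  refine ⟨?_, hxU, ?_⟩
  · by_contra hg
    have hg0 : 0 < Nat.gcd c d := Nat.gcd_pos_of_pos_left _ hc
    obtain ⟨k, hk⟩ : ∃ k, Nat.gcd c d = k + 2 := by
      have : Nat.gcd c d ≠ 1 := hg
      exact ⟨Nat.gcd c d - 2, by omega⟩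
    obtain ⟨c', hc'⟩ := Nat.gcd_dvd_left c d
    obtain ⟨d', hd'⟩ := Nat.gcd_dvd_right c d
    rw [hk] at hc' hd'
    subst hc' hd'
    have hU' : (d' : ℝ) * Q < c' * P := by
      push_cast at hxU
      have : ((k : ℝ) + 2) * (d' * Q) < (k + 2) * (c' * P) := by linarith
      exact lt_of_mul_lt_mul_left this (by positivity)
    refine no_split hP hQ ht s hmin (c', d') ((k + 1) * c', (k + 1) * d') ?_ hU' ?_
    · convert hx using 1
      simp only [Prod.mk_add_mk, Prod.mk.injEq]
      constructor <;> ring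
    · push_cast
      have := mul_lt_mul_of_pos_left hU' (show (0 : ℝ) < k + 1 by positivity)
      linarith
  · rintro ⟨m, n⟩ hmn hle
    simp only at hmn hle ⊢
    by_contra! hcon
    -- m * d < c * n
    have hnd : n ≤ d := by
      by_contra! h
      apply hfl
      have h1 : (d + 1 : ℝ) ≤ n := by exact_mod_cast h
      have h2 : (m : ℝ) ≤ c := by exact_mod_cast hle
      nlinarith
    obtain ⟨e, rfl⟩ := Nat.exists_eq_add_of_le hle
    obtain ⟨f, rfl⟩ := Nat.exists_eq_add_of_le hnd
    refine no_split hP hQ ht s hmin (m, n) (e, f) ?_ hmn ?_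
    · simpa using hx
    · simp only
      have h1 : m * f < e * n := by nlinarith
      have h2 : (m : ℝ) * f < e * n := by exact_mod_cast h1
      have hm : 0 < (m : ℝ) * P := lt_of_le_of_lt (by positivity) hmn
      have hm' : 0 < (m : ℝ) := pos_of_mul_pos_left hm hP.le
      have h3 : (m : ℝ) * (f * Q) < m * (e * P) := by
        have he : (0 : ℝ) ≤ e := by positivity
        have := mul_lt_mul_of_pos_right h2 hQ
        have := mul_le_mul_of_nonneg_left hmn.le he
        nlinarith
      exact lt_of_mul_lt_mul_left h3 hm'.le

lemma all_best {P Q t : ℝ} (hP : 0 < P) (hQ : 0 < Q)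
    (hirr : ∀ x : ℕ × ℕ, (x.1 : ℝ) * P = x.2 * Q → x = 0) (ht : 1 < t)
    (s : Multiset (ℕ × ℕ)) (h0 : 0 ∉ s)
    (hmin : ∀ s' : Multiset (ℕ × ℕ), s'.sum = s.sum → W P Q t s ≤ W P Q t s')
    (hs : Best P Q s.sum ∨ Best Q P s.sum.swap)
    (x : ℕ × ℕ) (hx : x ∈ s) : Best P Q x ∨ Best Q P x.swap := by
  rcases lt_trichotomy ((x.2 : ℝ) * Q) (x.1 * P) with h | h | h
  · exact Or.inl (upper_best hP hQ hirr ht s h0 hmin hs x hx h)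
  · exact absurd hx (by rw [hirr x h.symm]; exact h0)
  · right
    refine upper_best hQ hP ?_ ht (s.map Prod.swap) ?_ ?_ ?_ x.swap ?_ ?_
    · intro y hy
      have := hirr y.swap (by simpa using hy.symm)
      simpa [Prod.ext_iff, and_comm] using this
    · intro h
      obtain ⟨y, hy, hy0⟩ := Multiset.mem_map.1 h
      apply h0
      have : y = 0 := by simpa [Prod.ext_iff, and_comm] using hy0
      rwa [← this]
    · intro s' hs'
      have := hmin (s'.map Prod.swap) (by rw [sum_swap, hs', sum_swap]; simp)
      rw [W_swap]
      rwa [W_swap] at this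
    · rw [sum_swap]; simpa using hs.symm
    · exact Multiset.mem_map_of_mem _ hx
    · simpa using h

lemma finite_fact (T : ℕ × ℕ) : {s : Multiset (ℕ × ℕ) | s.sum = T ∧ 0 ∉ s}.Finite := by
  refine (Set.finite_Iic ((T.1 + T.2) • (Finset.Iic T).val)).subset ?_
  rintro s ⟨hs, h0⟩
  have hcard : ∀ s : Multiset (ℕ × ℕ), 0 ∉ s → s.card ≤ s.sum.1 + s.sum.2 := by
    intro s
    induction s using Multiset.induction_on with
    | empty => simp
    | cons x s ih =>
      intro h
      have h1 := ih (fun h' => h (by simp [h']))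
      have h2 : x ≠ 0 := fun h' => h (by simp [h'])
      have h3 : x.1 ≠ 0 ∨ x.2 ≠ 0 := by
        by_contra! h'
        exact h2 (Prod.ext h'.1 h'.2)
      simp only [Multiset.card_cons, Multiset.sum_cons, Prod.fst_add, Prod.snd_add]
      omega
  rw [Set.mem_Iic, Multiset.le_iff_count]
  intro x
  by_cases hx : x ∈ s
  · have hxT : x ≤ T := hs ▸ Multiset.le_sum_of_mem hx
    have h1 : Multiset.count x (Finset.Iic T).val = 1 :=
      Multiset.count_eq_one_of_mem (Finset.nodup _) (by simpa using hxT)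
    rw [Multiset.count_nsmul, h1, mul_one, ← hs]
    exact (Multiset.count_le_card _ _).trans (hcard s h0)
  · rw [Multiset.count_eq_zero_of_notMem hx]; exact Nat.zero_le _

lemma filter_zero {P Q t : ℝ} (ht : 0 < t) (s : Multiset (ℕ × ℕ)) :
    ∃ s' : Multiset (ℕ × ℕ), 0 ∉ s' ∧ s'.sum = s.sum ∧ W P Q t s' = W P Q t s := by
  induction s using Multiset.induction_on with
  | empty => exact ⟨0, by simp⟩
  | cons x s ih =>
    obtain ⟨s', h0, h1, h2⟩ := ih
    by_cases hx : x = 0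
    · refine ⟨s', h0, by simp [hx, h1], ?_⟩
      rw [W_cons, hx, wt_zero, Real.zero_rpow ht.ne', h2, zero_add]
    · exact ⟨x ::ₘ s', by simp [h0, Ne.symm hx], by simp [h1], by rw [W_cons, W_cons, h2]⟩

lemma exists_min (P Q : ℝ) {t : ℝ} (ht : 0 < t) (T : ℕ × ℕ) :
    ∃ s : Multiset (ℕ × ℕ), 0 ∉ s ∧ s.sum = T ∧
      ∀ s' : Multiset (ℕ × ℕ), s'.sum = T → W P Q t s ≤ W P Q t s' := by
  have hne : {s : Multiset (ℕ × ℕ) | s.sum = T ∧ 0 ∉ s}.Nonempty := by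
    obtain ⟨s', h0, h1, -⟩ := filter_zero (P := P) (Q := Q) ht {T}
    exact ⟨s', by simpa using h1, h0⟩
  obtain ⟨s, ⟨hs, h0⟩, hm⟩ := Set.exists_min_image _ (W P Q t) (finite_fact T) hne
  refine ⟨s, h0, hs, fun s' hs' => ?_⟩
  obtain ⟨s'', h0', h1, h2⟩ := filter_zero (P := P) (Q := Q) ht s'
  rw [← h2]
  exact hm s'' ⟨h1.trans hs', h0'⟩

lemma main_abs {P Q t : ℝ} (hP : 0 < P) (hQ : 0 < Q)
    (hirr : ∀ x : ℕ × ℕ, (x.1 : ℝ) * P = x.2 * Q → x = 0) (ht : 0 < t) (T : ℕ × ℕ)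
    (hT0 : T ≠ 0) (hT : Best P Q T ∨ Best Q P T.swap) :
    ∃ s : Multiset (ℕ × ℕ), 0 ∉ s ∧ s.sum = T ∧ (∀ x ∈ s, Best P Q x ∨ Best Q P x.swap) ∧
      ∀ s' : Multiset (ℕ × ℕ), s'.sum = T → W P Q t s ≤ W P Q t s' := by
  rcases le_or_gt t 1 with h1 | h1
  · refine ⟨{T}, by simpa using hT0.symm, by simp, by simpa using hT, ?_⟩
    rintro s' rfl
    simpa [W] using W_small (Q := Q) hP ht h1 s'
  · obtain ⟨s, h0, rfl, hm⟩ := exists_min P Q ht T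
    exact ⟨s, h0, rfl, all_best hP hQ hirr h1 s h0 hm hT, hm⟩

lemma best_iff {P Q ξ : ℝ} (hP : 0 < P) (hQ : 0 < Q) (hξ : ξ = Q / P) (x : ℕ × ℕ) :
    BestApprox ξ x ↔ Best P Q x ∨ Best Q P x.swap := by
  have hU : ∀ y : ℕ × ℕ, y ∈ Uset ξ ↔ (y.2 : ℝ) * Q < y.1 * P := by
    intro y
    have : (y.2 : ℝ) * ξ < y.1 ↔ (y.2 : ℝ) * Q < y.1 * P := by
      rw [hξ, ← mul_div_assoc, div_lt_iff₀ hP]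
    simp only [Uset, Set.mem_setOf_eq, this, and_iff_right_iff_imp]
    rintro h rfl
    simp at h
  have hL : ∀ y : ℕ × ℕ, y ∈ Lset ξ ↔ (y.1 : ℝ) * P < y.2 * Q := by
    intro y
    have : (y.1 : ℝ) < y.2 * ξ ↔ (y.1 : ℝ) * P < y.2 * Q := by
      rw [hξ, ← mul_div_assoc, lt_div_iff₀ hP]
    simp only [Lset, Set.mem_setOf_eq, this, and_iff_right_iff_imp]
    rintro h rfl
    simp at h
  unfold BestApprox
  apply or_congr
  · simp only [Gset, U1, Best, Set.mem_inter_iff, Set.mem_setOf_eq, hU]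
    constructor
    · rintro ⟨⟨_, h1⟩, h2, h3⟩; exact ⟨h1, h2, h3⟩
    · rintro ⟨h1, h2, h3⟩
      refine ⟨⟨?_, h1⟩, h2, h3⟩
      rintro rfl; simp at h2
  · simp only [Gset, L2, Best, Set.mem_inter_iff, Set.mem_setOf_eq, hL, Prod.fst_swap,
      Prod.snd_swap]
    constructor
    · rintro ⟨⟨_, h1⟩, h2, h3⟩
      refine ⟨h1.symm, h2, fun y hy hyx => ?_⟩
      have := h3 y.swap (by simpa using hy) (by simpa using hyx)
      simp only [Prod.fst_swap, Prod.snd_swap] at this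
      linarith
    · rintro ⟨h1, h2, h3⟩
      refine ⟨⟨?_, h1.symm⟩, h2, fun y hy hyx => ?_⟩
      · rintro rfl; simp at h2
      · have := h3 y.swap (by simpa using hy) (by simpa using hyx)
        simp only [Prod.fst_swap, Prod.snd_swap] at this
        linarith

lemma pow_eq {p q : ℕ} (hp : p.Prime) (hq : q.Prime) (hpq : p ≠ q) {k l : ℕ}
    (h : p ^ k = q ^ l) : k = 0 ∧ l = 0 := by
  have hc : Nat.Coprime (p ^ k) (q ^ l) := Nat.Coprime.pow _ _ ((Nat.coprime_primes hp hq).2 hpq)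
  rw [← h, Nat.coprime_self] at hc
  have hk : k = 0 := by
    rcases Nat.pow_eq_one.1 hc with h | h
    · exact absurd h hp.one_lt.ne'
    · exact h
  rw [hc] at h
  refine ⟨hk, ?_⟩
  rcases Nat.pow_eq_one.1 h.symm with h | h
  · exact absurd h hq.one_lt.ne'
  · exact h

lemma log_max {p q : ℕ} (hp : p.Prime) (hq : q.Prime) (k l : ℕ) :
    Real.log ((max (p ^ k) (q ^ l) : ℕ) : ℝ) = wt (Real.log p) (Real.log q) (k, l) := by
  have hp0 : (0 : ℝ) < p := by exact_mod_cast hp.pos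
  have hq0 : (0 : ℝ) < q := by exact_mod_cast hq.pos
  have hm : Real.log (max ((p : ℝ) ^ k) ((q : ℝ) ^ l)) =
      max (Real.log ((p : ℝ) ^ k)) (Real.log ((q : ℝ) ^ l)) := by
    rcases le_total ((p : ℝ) ^ k) ((q : ℝ) ^ l) with h | h
    · rw [max_eq_right h, max_eq_right (Real.log_le_log (by positivity) h)]
    · rw [max_eq_left h, max_eq_left (Real.log_le_log (by positivity) h)]
  push_cast
  rw [hm, Real.log_pow, Real.log_pow, wt]

lemma fmeas_eq {p q : ℕ} (hp : p.Prime) (hq : q.Prime) {N : ℕ} (A B : Fin N → ℕ) (t : ℝ) :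
    fmeas (fun n => p ^ A n) (fun n => q ^ B n) t =
      (W (Real.log p) (Real.log q) t
        ((Finset.univ : Finset (Fin N)).val.map fun n => (A n, B n))) ^ (1 / t) := by
  simp only [fmeas, log_max hp hq, W, Multiset.map_map, Function.comp_def]
  rfl

lemma W_nonneg {P Q t : ℝ} (hP : 0 < P) (s : Multiset (ℕ × ℕ)) : 0 ≤ W P Q t s := by
  apply Multiset.sum_nonneg
  intro x hx
  obtain ⟨y, _, rfl⟩ := Multiset.mem_map.1 hx
  exact Real.rpow_nonneg (wt_nonneg hP _) _

lemma sum_pairs {N : ℕ} (A B : Fin N → ℕ) :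
    ((Finset.univ : Finset (Fin N)).val.map fun n => (A n, B n)).sum = (∑ n, A n, ∑ n, B n) := by
  change ∑ n, (A n, B n) = _
  ext <;> simp [Prod.fst_sum, Prod.snd_sum]

lemma fact_exponents {p q : ℕ} (hp : p.Prime) (hq : q.Prime) (hpq : p ≠ q) {a b M : ℕ}
    {r s : Fin M → ℕ} (h : IsFactorization ((p : ℚ) ^ a / (q : ℚ) ^ b) r s) :
    ∃ A B : Fin M → ℕ, r = (fun n => p ^ A n) ∧ s = (fun n => q ^ B n) ∧
      ∑ n, A n = a ∧ ∑ n, B n = b := by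
  obtain ⟨hr, hs, -, hc, hprod⟩ := h
  have hq0 : (q : ℚ) ≠ 0 := by exact_mod_cast hq.ne_zero
  have hS0 : (∏ n, (s n : ℚ)) ≠ 0 := Finset.prod_ne_zero_iff.2 fun n _ => by
    exact_mod_cast (hs n).ne'
  rw [Finset.prod_div_distrib, div_eq_div_iff hS0 (pow_ne_zero _ hq0)] at hprod
  have hprod' : (∏ n, r n) * q ^ b = p ^ a * ∏ n, s n := by exact_mod_cast hprod
  have hRS : Nat.Coprime (∏ n, r n) (∏ n, s n) :=
    Nat.Coprime.prod_left fun m _ => Nat.Coprime.prod_right fun n _ => hc m n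
  have hPQ : Nat.Coprime (p ^ a) (q ^ b) :=
    Nat.Coprime.pow _ _ ((Nat.coprime_primes hp hq).2 hpq)
  have hR : ∏ n, r n = p ^ a := by
    apply Nat.dvd_antisymm
    · exact hRS.dvd_of_dvd_mul_right (Dvd.intro _ hprod')
    · exact hPQ.dvd_of_dvd_mul_right (Dvd.intro _ hprod'.symm)
  have hS : ∏ n, s n = q ^ b := by
    rw [hR] at hprod'
    exact (Nat.eq_of_mul_eq_mul_left (pow_pos hp.pos _) hprod').symm
  have h1 : ∀ n, ∃ k, r n = p ^ k := fun n => by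
    obtain ⟨k, _, hk⟩ := (Nat.dvd_prime_pow hp).1
      (hR ▸ Finset.dvd_prod_of_mem r (Finset.mem_univ n))
    exact ⟨k, hk⟩
  have h2 : ∀ n, ∃ k, s n = q ^ k := fun n => by
    obtain ⟨k, _, hk⟩ := (Nat.dvd_prime_pow hq).1
      (hS ▸ Finset.dvd_prod_of_mem s (Finset.mem_univ n))
    exact ⟨k, hk⟩
  choose A hA using h1
  choose B hB using h2
  refine ⟨A, B, funext hA, funext hB, ?_, ?_⟩
  · simp only [hA, Finset.prod_pow_eq_pow_sum] at hR
    exact Nat.pow_right_injective hp.two_le hR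
  · simp only [hB, Finset.prod_pow_eq_pow_sum] at hS
    exact Nat.pow_right_injective hq.two_le hS

lemma multiset_fin (s : Multiset (ℕ × ℕ)) : ∃ (N : ℕ) (A B : Fin N → ℕ),
    (Finset.univ : Finset (Fin N)).val.map (fun n => (A n, B n)) = s := by
  induction s using Quotient.inductionOn with
  | h l =>
    refine ⟨l.length, fun n => (l.get n).1, fun n => (l.get n).2, ?_⟩
    simp [Fin.univ_val_map]

end MainCorAux

open MainCorAux in
/-- Corollary `MainCor`: if `(a,b)` is an upper or lower best
approximation for `ξ = log q / log p`, then `ℬ(α)` is an infimum set for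
`α = p^a/q^b`: for every `t > 0` there is a factorization of `α` all of whose exponent
pairs are upper or lower best approximations for `ξ` whose measure function at `t` is
minimal among all factorizations in `ℱ(α)`. -/
theorem stmt_2 (p q : ℕ) (hp : p.Prime) (hq : q.Prime) (hpq : p ≠ q)
    (ξ : ℝ) (hξ : ξ = Real.log q / Real.log p)
    (a b : ℕ) (hba : BestApprox ξ (a, b)) :
    ∀ t : ℝ, 0 < t → ∃ (N : ℕ) (A B : Fin N → ℕ),
      IsFactorization ((p : ℚ) ^ a / (q : ℚ) ^ b)
        (fun n => p ^ A n) (fun n => q ^ B n) ∧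
      (∀ n : Fin N, BestApprox ξ (A n, B n)) ∧
      (∀ (M : ℕ) (r s : Fin M → ℕ),
        IsFactorization ((p : ℚ) ^ a / (q : ℚ) ^ b) r s →
        fmeas (fun n => p ^ A n) (fun n => q ^ B n) t ≤ fmeas r s t) := by
  intro t ht
  have hP : 0 < Real.log p := Real.log_pos (by exact_mod_cast hp.one_lt)
  have hQ : 0 < Real.log q := Real.log_pos (by exact_mod_cast hq.one_lt)
  have hirr : ∀ x : ℕ × ℕ, (x.1 : ℝ) * Real.log p = x.2 * Real.log q → x = 0 := by
    intro x hx
    rw [← Real.log_pow, ← Real.log_pow] at hx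
    have hp0 : (0 : ℝ) < p := by exact_mod_cast hp.pos
    have hq0 : (0 : ℝ) < q := by exact_mod_cast hq.pos
    have h1 := Real.log_injOn_pos (Set.mem_Ioi.2 (pow_pos hp0 _)) (Set.mem_Ioi.2 (pow_pos hq0 _)) hx
    have h2 : p ^ x.1 = q ^ x.2 := by exact_mod_cast h1
    obtain ⟨h3, h4⟩ := pow_eq hp hq hpq h2
    exact Prod.ext h3 h4
  have hT0 : (a, b) ≠ (0 : ℕ × ℕ) := by
    rcases hba with h | h
    · exact h.1.1
    · exact h.1.1
  obtain ⟨s, h0, hsum, hbest, hmin⟩ := main_abs hP hQ hirr ht (a, b) hT0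
    ((best_iff hP hQ hξ _).1 hba)
  obtain ⟨N, A, B, rfl⟩ := multiset_fin s
  have hmem : ∀ n : Fin N, (A n, B n) ∈
      (Finset.univ : Finset (Fin N)).val.map (fun n => (A n, B n)) := fun n =>
    Multiset.mem_map_of_mem _ (Finset.mem_univ n)
  rw [sum_pairs, Prod.mk.injEq] at hsum
  refine ⟨N, A, B, ⟨fun n => pow_pos hp.pos _, fun n => pow_pos hq.pos _, ?_, ?_, ?_⟩, ?_, ?_⟩
  · intro n hn
    have hq0 : ((q ^ B n : ℕ) : ℚ) ≠ 0 := by exact_mod_cast pow_ne_zero _ hq.ne_zero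
    rw [div_eq_one_iff_eq hq0] at hn
    obtain ⟨h3, h4⟩ := pow_eq hp hq hpq (k := A n) (l := B n) (by exact_mod_cast hn)
    apply h0
    have := hmem n
    rw [h3, h4] at this
    exact this
  · intro m n
    exact Nat.Coprime.pow _ _ ((Nat.coprime_primes hp hq).2 hpq)
  · rw [Finset.prod_div_distrib]
    push_cast
    rw [Finset.prod_pow_eq_pow_sum, Finset.prod_pow_eq_pow_sum, hsum.1, hsum.2]
  · intro n
    exact (best_iff hP hQ hξ _).2 (hbest _ (hmem n))
  · intro M r s hrs
    obtain ⟨A', B', rfl, rfl, hA', hB'⟩ := fact_exponents hp hq hpq hrs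
    rw [fmeas_eq hp hq, fmeas_eq hp hq]
    apply Real.rpow_le_rpow (W_nonneg hP _) _ (by positivity)
    apply hmin
    rw [sum_pairs, hA', hB']
end

section
/- For every even positive integer n there exist prime numbers p and q such that hₙ/hₙ₋₁ < (log q)/(log p) < hₙ₊₁/hₙ, where (hₙ) is the Fibonacci sequence. -/
open Real Finset

theorem cassini_even (k : ℕ) :
    Nat.fib (2 * k + 2) ^ 2 + 1 = Nat.fib (2 * k + 3) * Nat.fib (2 * k + 1) := by
  induction k with
  | zero => decide
  | succ k ih =>
    have h3 : Nat.fib (2 * k + 3) = Nat.fib (2 * k + 1) + Nat.fib (2 * k + 2) := Nat.fib_add_two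
    have h4 : Nat.fib (2 * k + 4) = Nat.fib (2 * k + 2) + Nat.fib (2 * k + 3) := Nat.fib_add_two
    have h5 : Nat.fib (2 * k + 5) = Nat.fib (2 * k + 3) + Nat.fib (2 * k + 4) := Nat.fib_add_two
    change Nat.fib (2 * k + 4) ^ 2 + 1 = Nat.fib (2 * k + 5) * Nat.fib (2 * k + 3)
    rw [h5, h4, h3]
    rw [h3] at ih
    nlinarith [ih]

/-- Quotients of logarithms of primes are dense in the positive reals. -/
theorem exists_primes_log_ratio (a b : ℝ) (ha : 0 < a) (hab : a < b) :
    ∃ p q : ℕ, p.Prime ∧ q.Prime ∧ a < Real.log q / Real.log p ∧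
      Real.log q / Real.log p < b := by
  have hd : 0 < b - a := sub_pos.2 hab
  obtain ⟨N, hN⟩ := exists_nat_gt ((4 : ℝ) ^ (1 / (b - a)))
  obtain ⟨p, hpN, hp⟩ := Nat.exists_infinite_primes N
  have hp1 : (1 : ℝ) < p := by exact_mod_cast hp.one_lt
  have hp0 : (0 : ℝ) < p := by linarith
  have hlog : 0 < Real.log p := Real.log_pos hp1
  have hpN' : (4 : ℝ) ^ (1 / (b - a)) < p := hN.trans_le (by exact_mod_cast hpN)
  have h4 : (4 : ℝ) < (p : ℝ) ^ (b - a) := by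
    have h := Real.rpow_lt_rpow (by positivity) hpN' hd
    rwa [← Real.rpow_mul (by norm_num), one_div_mul_cancel hd.ne', Real.rpow_one] at h
  have hpa : 1 ≤ (p : ℝ) ^ a := Real.one_le_rpow hp1.le ha.le
  have hpb : 4 * (p : ℝ) ^ a < (p : ℝ) ^ b := by
    have : (p : ℝ) ^ b = (p : ℝ) ^ (b - a) * (p : ℝ) ^ a := by
      rw [← Real.rpow_add hp0]; congr 1; ring
    rw [this]
    exact mul_lt_mul_of_pos_right h4 (by linarith)
  obtain ⟨q, hq, hmq, hqm⟩ :=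
    Nat.exists_prime_lt_and_le_two_mul (⌊(p : ℝ) ^ a⌋₊ + 1) (Nat.succ_ne_zero _)
  have h1 : (p : ℝ) ^ a < q := by
    have := Nat.lt_floor_add_one ((p : ℝ) ^ a)
    have h' : ((⌊(p : ℝ) ^ a⌋₊ + 1 : ℕ) : ℝ) < q := by exact_mod_cast hmq
    push_cast at h'
    linarith
  have h2 : (q : ℝ) < (p : ℝ) ^ b := by
    have := Nat.floor_le (a := (p : ℝ) ^ a) (by linarith)
    have h' : (q : ℝ) ≤ ((2 * (⌊(p : ℝ) ^ a⌋₊ + 1) : ℕ) : ℝ) := by exact_mod_cast hqm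
    push_cast at h'
    linarith
  refine ⟨p, q, hp, hq, ?_, ?_⟩
  · rw [lt_div_iff₀ hlog, ← Real.log_rpow hp0]
    exact Real.log_lt_log (by linarith) h1
  · rw [div_lt_iff₀ hlog, ← Real.log_rpow hp0]
    exact Real.log_lt_log (by linarith) h2

/-- Theorem `GRApprox` (i): for every even positive integer `n` there are
primes `p`, `q` with `hₙ/hₙ₋₁ < log q / log p < hₙ₊₁/hₙ`, where `h` is the Fibonacci
sequence. -/
theorem stmt_4 (n : ℕ) (hn : 0 < n) (hne : Even n) :
    ∃ p q : ℕ, p.Prime ∧ q.Prime ∧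
      (Nat.fib n : ℝ) / (Nat.fib (n - 1) : ℝ) < Real.log q / Real.log p ∧
      Real.log q / Real.log p < (Nat.fib (n + 1) : ℝ) / (Nat.fib n : ℝ) := by
  obtain ⟨m, rfl⟩ := hne
  obtain ⟨k, rfl⟩ : ∃ k, m = k + 1 := ⟨m - 1, by omega⟩
  have e0 : k + 1 + (k + 1) = 2 * k + 2 := by ring
  rw [e0]
  have e1 : 2 * k + 2 - 1 = 2 * k + 1 := by omega
  rw [e1]
  have hx : (0 : ℝ) < Nat.fib (2 * k + 1) := by exact_mod_cast Nat.fib_pos.2 (by omega)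
  have hy : (0 : ℝ) < Nat.fib (2 * k + 2) := by exact_mod_cast Nat.fib_pos.2 (by omega)
  apply exists_primes_log_ratio _ _ (div_pos hy hx)
  rw [div_lt_div_iff₀ hx hy]
  have h : (Nat.fib (2 * k + 2) : ℝ) ^ 2 + 1 = Nat.fib (2 * k + 3) * Nat.fib (2 * k + 1) := by
    exact_mod_cast cassini_even k
  change _ < (Nat.fib (2 * k + 3) : ℝ) * _
  nlinarith
end
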